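/- Let x₀ > 0 and let φ be a nonnegative differentiable function on [x₀,∞) such that y(x) = x + φ(x) is strictly increasing, with inverse x(y) defined on [y₀,∞) where y₀ = y(x₀), and set ψ(y) = y − x(y). Assume there exist constants C > 0 and y* ≥ y₀ such that for all y ≥ y*: (a) ψ′(y) ∈ [0,1], (b) ψ(y) ≤ C·log y, and (c) y·ψ′(y) ≤ C. Let Y be a random variable taking values in [0,∞) with distribution function G having finite moments ν_n = E[Y^n] of all positive integer orders, such that G is absolutely continuous on [x₀,∞) with density g(x) = G′(x) > 0 there. If limsup_{x→∞} g(x+φ(x)) / g(x) < 1, then both ∑_{n=1}^∞ ν_n^{−1/(2n)} = ∞ and ∑_{n=1}^∞ ν_{2n}^{−1/(2n)} = ∞; consequently the distributions of both Y and Y² are uniquely determined by their moments among all probability distributions on [0,∞). -/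

import Mathlib

open MeasureTheory Filter Set

/-- Moment-determinacy on `ℝ₊` among all probability distributions on `[0,∞)`. -/
def IsMomentDetOnNonneg (μ : Measure ℝ) : Prop :=
  ∀ ν : Measure ℝ, IsProbabilityMeasure ν → ν (Set.Iio 0) = 0 →
    (∀ n : ℕ, 0 < n → Integrable (fun x => x ^ n) ν ∧
      ∫ x, x ^ n ∂ν = ∫ x, x ^ n ∂μ) → ν = μ

section DenjoyCarleman

variable {E : Type*} [NormedAddCommGroup E] [NormedSpace ℝ E]

/-- Bang's propagation estimate: smallness of all derivatives at `x`, measured against the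
weights `M₀ * ∏ i ∈ range n, r i`, degrades by at most a factor `e` over a distance
`1 / (e * r N)`. -/
theorem norm_le_exp_mul_of_bang_step {f : ℕ → ℝ → E} {r : ℕ → ℝ} {M₀ : ℝ}
    (hf : ∀ n x, HasDerivAt (f n) (f (n + 1) x) x) (hr : ∀ n, 0 < r n) (hmono : Monotone r)
    (hM₀ : 0 ≤ M₀) (hbound : ∀ n x, ‖f n x‖ ≤ M₀ * ∏ i ∈ Finset.range n, r i)
    {N : ℕ} {x h : ℝ} (h0 : 0 ≤ h) (hh : h ≤ (Real.exp 1 * r N)⁻¹)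
    (hx : ∀ n : ℕ, ‖f n x‖ ≤ Real.exp (n - (N + 1)) * (M₀ * ∏ i ∈ Finset.range n, r i)) (n : ℕ) :
    ‖f n (x + h)‖ ≤ Real.exp (n - N) * (M₀ * ∏ i ∈ Finset.range n, r i) := by
  have hM : ∀ n, 0 ≤ M₀ * ∏ i ∈ Finset.range n, r i := fun n =>
    mul_nonneg hM₀ (Finset.prod_nonneg fun i _ => (hr i).le)
  rcases le_or_gt N n with hn | hn
  · refine (hbound n _).trans (le_mul_of_one_le_left (hM n) (Real.one_le_exp ?_))
    have : (N : ℝ) ≤ n := by exact_mod_cast hn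
    linarith
  have key : ∀ k ≤ N + 1, ∀ y ∈ Icc x (x + h), ‖f k y‖ ≤
      Real.exp (k - (N + 1)) * (M₀ * ∏ i ∈ Finset.range k, r i) *
        Real.exp (Real.exp 1 * r N * (y - x)) := by
    intro k hk
    induction hk using Nat.decreasingInduction with
    | self =>
      intro y hy
      refine (hbound _ y).trans ?_
      have h1 : 1 ≤ Real.exp (Real.exp 1 * r N * (y - x)) :=
        Real.one_le_exp (mul_nonneg (mul_nonneg (Real.exp_pos 1).le (hr N).le)
          (sub_nonneg.2 hy.1))
      push_cast
      rw [sub_self, Real.exp_zero, one_mul]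
      exact le_mul_of_one_le_right (hM _) h1
    | of_succ k hk ih =>
      have hB : ∀ y, HasDerivAt (fun y => Real.exp (k - (N + 1)) *
          (M₀ * ∏ i ∈ Finset.range k, r i) * Real.exp (Real.exp 1 * r N * (y - x)))
          (Real.exp (k - (N + 1)) * (M₀ * ∏ i ∈ Finset.range k, r i) *
            (Real.exp (Real.exp 1 * r N * (y - x)) * (Real.exp 1 * r N * 1))) y := fun y =>
        ((((hasDerivAt_id y).sub_const x).const_mul _).exp).const_mul _
      refine image_norm_le_of_norm_deriv_right_le_deriv_boundary (f' := f (k + 1))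
        (fun y _ => (hf k y).continuousAt.continuousWithinAt)
        (fun y _ => (hf k y).hasDerivWithinAt) ?_ hB ?_
      · simpa using hx k
      · intro y hy
        refine (ih y (Ico_subset_Icc_self hy)).trans ?_
        rw [Finset.prod_range_succ, Nat.cast_succ,
          show ((k : ℝ) + 1 - (N + 1)) = (k - (N + 1)) + 1 by ring, Real.exp_add]
        have hrk : r k ≤ r N := hmono (by omega)
        have h3 : 0 ≤ Real.exp (k - (N + 1)) * (M₀ * ∏ i ∈ Finset.range k, r i) *
            Real.exp (Real.exp 1 * r N * (y - x)) * Real.exp 1 :=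
          mul_nonneg (mul_nonneg (mul_nonneg (Real.exp_pos _).le (hM k)) (Real.exp_pos _).le)
            (Real.exp_pos _).le
        have := mul_le_mul_of_nonneg_left hrk h3
        linarith
  refine (key n (by omega) (x + h) ⟨by linarith, le_rfl⟩).trans ?_
  have h2 : Real.exp 1 * r N * (x + h - x) ≤ 1 := by
    have hpos : 0 < Real.exp 1 * r N := mul_pos (Real.exp_pos 1) (hr N)
    calc _ = Real.exp 1 * r N * h := by ring
      _ ≤ Real.exp 1 * r N * (Real.exp 1 * r N)⁻¹ := mul_le_mul_of_nonneg_left hh hpos.le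
      _ = 1 := mul_inv_cancel₀ hpos.ne'
  calc _ ≤ Real.exp (n - (N + 1)) * (M₀ * ∏ i ∈ Finset.range n, r i) * Real.exp 1 :=
        mul_le_mul_of_nonneg_left (Real.exp_le_exp.2 h2) (mul_nonneg (Real.exp_pos _).le (hM n))
    _ = _ := by
      rw [show (n : ℝ) - N = (n - (N + 1)) + 1 by ring, Real.exp_add]
      ring

/-- Denjoy–Carleman quasi-analyticity on a half-line. -/
theorem eq_zero_of_flat_of_not_summable_inv {f : ℕ → ℝ → E} {r : ℕ → ℝ} {M₀ : ℝ}
    (hf : ∀ n x, HasDerivAt (f n) (f (n + 1) x) x) (hr : ∀ n, 0 < r n) (hmono : Monotone r)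
    (hM₀ : 0 ≤ M₀) (hbound : ∀ n x, ‖f n x‖ ≤ M₀ * ∏ i ∈ Finset.range n, r i)
    (hsum : ¬ Summable fun n => (r n)⁻¹) (hflat : ∀ n, f n 0 = 0) {t : ℝ} (ht : 0 ≤ t) :
    f 0 t = 0 := by
  have hM : ∀ n, 0 ≤ M₀ * ∏ i ∈ Finset.range n, r i := fun n =>
    mul_nonneg hM₀ (Finset.prod_nonneg fun i _ => (hr i).le)
  have iter : ∀ m K : ℕ, ∀ x s : ℝ, 0 ≤ s →
      s ≤ ∑ i ∈ Finset.range K, (Real.exp 1 * r (m + i))⁻¹ →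
      (∀ n : ℕ, ‖f n x‖ ≤ Real.exp (n - (m + K)) * (M₀ * ∏ i ∈ Finset.range n, r i)) →
      ∀ n : ℕ, ‖f n (x + s)‖ ≤ Real.exp (n - m) * (M₀ * ∏ i ∈ Finset.range n, r i) := by
    intro m K
    induction K with
    | zero =>
      intro x s hs0 hs hx n
      obtain rfl : s = 0 := le_antisymm (by simpa using hs) hs0
      simpa using hx n
    | succ K ih =>
      intro x s hs0 hs hx n
      rw [Finset.sum_range_succ] at hs
      set S := ∑ i ∈ Finset.range K, (Real.exp 1 * r (m + i))⁻¹ with hS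
      have hS0 : 0 ≤ S := Finset.sum_nonneg fun i _ =>
        inv_nonneg.2 (mul_pos (Real.exp_pos 1) (hr _)).le
      have hinv : 0 ≤ (Real.exp 1 * r (m + K))⁻¹ :=
        inv_nonneg.2 (mul_pos (Real.exp_pos 1) (hr _)).le
      have hstep := norm_le_exp_mul_of_bang_step hf hr hmono hM₀ hbound
        (N := m + K) (x := x) (h := max 0 (s - S)) (le_max_left _ _)
        (max_le hinv (by linarith)) (by
          intro n
          have := hx n
          push_cast at this ⊢
          rwa [add_assoc])
      have := ih (x + max 0 (s - S)) (s - max 0 (s - S))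
        (by rcases max_cases 0 (s - S) with h | h <;> rw [h.1] <;> linarith)
        (by linarith [le_max_right 0 (s - S)])
        (by simpa using hstep) n
      convert this using 3
      ring
  have hle : ∀ m : ℕ, ‖f 0 t‖ ≤ Real.exp (-(m : ℝ)) * M₀ := by
    intro m
    have hdiv : ¬ Summable fun i => (Real.exp 1 * r (m + i))⁻¹ := by
      simp_rw [mul_inv]
      rw [summable_mul_left_iff (inv_ne_zero (Real.exp_pos 1).ne')]
      simp_rw [add_comm m]
      rwa [summable_nat_add_iff (f := fun i => (r i)⁻¹) m]
    have htend := (not_summable_iff_tendsto_nat_atTop_of_nonneg (fun i =>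
      inv_nonneg.2 (mul_pos (Real.exp_pos 1) (hr (m + i))).le)).1 hdiv
    obtain ⟨K, hK⟩ := (htend.eventually_ge_atTop t).exists
    have := iter m K 0 t ht hK (fun n => by
      rw [hflat, norm_zero]; exact mul_nonneg (Real.exp_pos _).le (hM n)) 0
    simpa using this
  have hlim : Tendsto (fun m : ℕ => Real.exp (-(m : ℝ)) * M₀) atTop (nhds 0) := by
    simpa using ((Real.tendsto_exp_neg_atTop_nhds_zero.comp
      tendsto_natCast_atTop_atTop).mul_const M₀)
  exact norm_le_zero_iff.1 (ge_of_tendsto' hlim hle)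

end DenjoyCarleman

lemma memLp_id_of_integrable_pow {σ : Measure ℝ} [IsFiniteMeasure σ]
    (h : ∀ n : ℕ, Integrable (fun x => x ^ n) σ) (n : ℕ) : MemLp id n σ := by
  rcases eq_or_ne n 0 with rfl | hn
  · simpa using aestronglyMeasurable_id
  · rw [← integrable_norm_rpow_iff aestronglyMeasurable_id (by simpa using hn) (by simp)]
    simpa using (h n).norm

/-- Hamburger determinacy under a log-convex moment bound of Carleman type. -/
theorem Measure.eq_of_moments_of_not_summable_inv {σ τ : Measure ℝ} [IsFiniteMeasure σ]
    [IsFiniteMeasure τ] {r : ℕ → ℝ} {M₀ : ℝ}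
    (hr : ∀ n, 0 < r n) (hmono : Monotone r) (hsum : ¬ Summable fun n => (r n)⁻¹)
    (hσ : ∀ n : ℕ, Integrable (fun x => x ^ n) σ) (hτ : ∀ n : ℕ, Integrable (fun x => x ^ n) τ)
    (heq : ∀ n : ℕ, ∫ x, x ^ n ∂σ = ∫ x, x ^ n ∂τ)
    (hσM : ∀ n : ℕ, ∫ x, |x| ^ n ∂σ ≤ M₀ * ∏ i ∈ Finset.range n, r i)
    (hτM : ∀ n : ℕ, ∫ x, |x| ^ n ∂τ ≤ M₀ * ∏ i ∈ Finset.range n, r i) : σ = τ := by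
  have hmσ := memLp_id_of_integrable_pow hσ
  have hmτ := memLp_id_of_integrable_pow hτ
  have hM₀ : 0 ≤ M₀ := by
    have h := hσM 0
    rw [Finset.range_zero, Finset.prod_empty, mul_one] at h
    exact (integral_nonneg fun x => by positivity).trans h
  have hderiv : ∀ (ρ : Measure ℝ) [IsFiniteMeasure ρ], (∀ n : ℕ, MemLp id n ρ) → ∀ n x,
      HasDerivAt (iteratedDeriv n (charFun ρ)) (iteratedDeriv (n + 1) (charFun ρ) x) x := by
    intro ρ _ hρ n x
    rw [iteratedDeriv_succ]
    exact (((contDiff_charFun (hρ (n + 1))).differentiable_iteratedDeriv n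
      (by exact_mod_cast Nat.lt_succ_self n)) x).hasDerivAt
  have hnorm : ∀ (ρ : Measure ℝ) [IsFiniteMeasure ρ], (∀ n : ℕ, MemLp id n ρ) → ∀ n x,
      ‖iteratedDeriv n (charFun ρ) x‖ ≤ ∫ y, |y| ^ n ∂ρ := by
    intro ρ _ hρ n x
    rw [iteratedDeriv_charFun (hρ n), norm_mul, norm_pow, Complex.norm_I, one_pow, one_mul]
    refine (norm_integral_le_integral_norm _).trans_eq (integral_congr_ae (.of_forall fun y => ?_))
    have : ‖Complex.exp (x * y * Complex.I)‖ = 1 := by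
      rw [← Complex.ofReal_mul, Complex.norm_exp_ofReal_mul_I]
    simp [this]
  have hnonneg : ∀ t : ℝ, 0 ≤ t → charFun σ t = charFun τ t := by
    intro t ht
    have := eq_zero_of_flat_of_not_summable_inv
      (f := fun n x => iteratedDeriv n (charFun σ) x - iteratedDeriv n (charFun τ) x)
      (r := r) (M₀ := 2 * M₀)
      (fun n x => (hderiv σ hmσ n x).sub (hderiv τ hmτ n x)) hr hmono (by positivity)
      (fun n x => (norm_sub_le _ _).trans (by
        linarith [hnorm σ hmσ n x, hnorm τ hmτ n x, hσM n, hτM n])) hsum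
      (fun n => by
        rw [iteratedDeriv_charFun_zero (hmσ n), iteratedDeriv_charFun_zero (hmτ n), heq, sub_self])
      ht
    simpa [sub_eq_zero] using this
  refine Measure.ext_of_charFun (funext fun t => ?_)
  rcases le_total 0 t with ht | ht
  · exact hnonneg t ht
  · rw [← neg_neg t, charFun_neg (μ := σ), charFun_neg (μ := τ), hnonneg (-t) (by linarith)]

lemma integral_abs_pow_le_of_even {σ : Measure ℝ} [IsFiniteMeasure σ] {r : ℕ → ℝ} {M₀ : ℝ}
    (hr : ∀ n, 0 < r n) (hr3 : ∀ n, r (n + 1) ≤ 3 * r n)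
    (hσ : ∀ n : ℕ, Integrable (fun x => x ^ n) σ)
    (hσM : ∀ n : ℕ, ∫ x, x ^ (2 * n) ∂σ ≤ M₀ * ∏ i ∈ Finset.range (2 * n), r i) (n : ℕ) :
    ∫ x, |x| ^ n ∂σ ≤ 2 * M₀ * ∏ i ∈ Finset.range n, r i := by
  have hM₀ : 0 ≤ M₀ := by
    have h := hσM 0
    rw [mul_zero, Finset.range_zero, Finset.prod_empty, mul_one] at h
    exact (integral_nonneg fun x => by positivity).trans h
  have hP : ∀ n, 0 < ∏ i ∈ Finset.range n, r i := fun n => Finset.prod_pos fun i _ => hr i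
  obtain ⟨k, rfl | rfl⟩ := Nat.even_or_odd' n
  · simp_rw [pow_mul, sq_abs, ← pow_mul]
    have := mul_nonneg hM₀ (hP (2 * k)).le
    linarith [hσM k]
  · have h1 := hσM k
    have h2 := hσM (k + 1)
    rw [show 2 * (k + 1) = 2 * k + 1 + 1 by ring, Finset.prod_range_succ,
      Finset.prod_range_succ] at h2
    rw [Finset.prod_range_succ]
    set P := ∏ i ∈ Finset.range (2 * k), r i
    have hl := hr (2 * k)
    have hpt : ∀ x : ℝ, |x| ^ (2 * k + 1) ≤
        r (2 * k) / 2 * x ^ (2 * k) + (r (2 * k))⁻¹ / 2 * x ^ (2 * k + 1 + 1) := by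
      intro x
      have e1 : x ^ (2 * k) = |x| ^ (2 * k) := by simp_rw [pow_mul, sq_abs]
      have e2 : x ^ (2 * k + 1 + 1) = |x| ^ (2 * k) * |x| ^ 2 := by
        rw [← e1, sq_abs]; ring
      rw [e1, e2, pow_succ]
      have h3 : |x| ≤ r (2 * k) / 2 + (r (2 * k))⁻¹ / 2 * |x| ^ 2 := by
        have := sq_nonneg (r (2 * k) - |x|)
        have e : r (2 * k) / 2 + (r (2 * k))⁻¹ / 2 * |x| ^ 2 - |x| =
          (r (2 * k) - |x|) ^ 2 * (r (2 * k))⁻¹ / 2 := by field_simp; ring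
        have : 0 ≤ (r (2 * k) - |x|) ^ 2 * (r (2 * k))⁻¹ / 2 := by positivity
        linarith
      have := mul_le_mul_of_nonneg_left h3 (by positivity : 0 ≤ |x| ^ (2 * k))
      linarith
    have hint : ∫ x, |x| ^ (2 * k + 1) ∂σ ≤ r (2 * k) / 2 * ∫ x, x ^ (2 * k) ∂σ +
        (r (2 * k))⁻¹ / 2 * ∫ x, x ^ (2 * k + 1 + 1) ∂σ := by
      rw [← integral_const_mul, ← integral_const_mul,
        ← integral_add ((hσ _).const_mul _) ((hσ _).const_mul _)]
      refine integral_mono ?_ (((hσ _).const_mul _).add ((hσ _).const_mul _)) hpt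
      simpa [abs_pow] using (hσ (2 * k + 1)).abs
    have h4 := mul_le_mul_of_nonneg_left h1 (by positivity : 0 ≤ r (2 * k) / 2)
    have h5 := mul_le_mul_of_nonneg_left h2 (by positivity : 0 ≤ (r (2 * k))⁻¹ / 2)
    have e5 : (r (2 * k))⁻¹ / 2 * (M₀ * (P * r (2 * k) * r (2 * k + 1))) =
        M₀ * P * r (2 * k + 1) / 2 := by field_simp
    rw [e5] at h5
    have h6 := mul_le_mul_of_nonneg_left (hr3 (2 * k)) (mul_nonneg hM₀ (hP (2 * k)).le)
    change M₀ * P * _ ≤ M₀ * P * _ at h6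
    linarith

/-- A probability measure on `[0, ∞)` is determined by its even moments under a Carleman-type
bound on them. -/
theorem eq_of_even_moments_of_nonneg {μ ν : Measure ℝ} [IsProbabilityMeasure μ]
    [IsProbabilityMeasure ν] {r : ℕ → ℝ} {M₀ : ℝ}
    (hr : ∀ n, 0 < r n) (hmono : Monotone r) (hr3 : ∀ n, r (n + 1) ≤ 3 * r n)
    (hsum : ¬ Summable fun n => (r n)⁻¹)
    (hμ0 : μ (Iio 0) = 0) (hν0 : ν (Iio 0) = 0)
    (hμ : ∀ n : ℕ, Integrable (fun x => x ^ n) μ)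
    (hν : ∀ n : ℕ, Integrable (fun x => x ^ (2 * n)) ν)
    (heq : ∀ n : ℕ, ∫ x, x ^ (2 * n) ∂ν = ∫ x, x ^ (2 * n) ∂μ)
    (hM : ∀ n : ℕ, ∫ x, x ^ (2 * n) ∂μ ≤ M₀ * ∏ i ∈ Finset.range (2 * n), r i) : ν = μ := by
  have hν' : ∀ n : ℕ, Integrable (fun x => x ^ n) ν := by
    intro n
    refine ((hν 0).add (hν n)).mono' (by fun_prop) (.of_forall fun x => ?_)
    have : |x| ^ n ≤ 1 + (|x| ^ n) ^ 2 := by nlinarith [sq_nonneg (|x| ^ n - 1)]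
    simp only [Pi.add_apply, mul_zero, pow_zero, Real.norm_eq_abs, abs_pow]
    rwa [← pow_mul, mul_comm n, pow_mul, sq_abs, ← pow_mul] at this
  have habsμ := integral_abs_pow_le_of_even hr hr3 hμ hM
  have habsν := integral_abs_pow_le_of_even hr hr3 hν' (fun n => (heq n).trans_le (hM n))
  have hneg : ∀ (ρ : Measure ℝ), (∀ n : ℕ, Integrable (fun x => x ^ n) ρ) → ∀ n : ℕ,
      Integrable (fun x : ℝ => x ^ n) (ρ.map Neg.neg) := by
    intro ρ hρ n
    rw [integrable_map_measure (by fun_prop) (by fun_prop)]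
    have : ((fun x : ℝ => x ^ n) ∘ Neg.neg) = fun x => (-1) ^ n * x ^ n := by
      ext x; simp [← mul_pow]
    rw [this]
    exact (hρ n).const_mul _
  have hint : ∀ (ρ : Measure ℝ), (∀ n : ℕ, Integrable (fun x => x ^ n) ρ) → ∀ n : ℕ,
      ∫ x, x ^ n ∂(ρ + ρ.map Neg.neg) = (1 + (-1) ^ n) * ∫ x, x ^ n ∂ρ := by
    intro ρ hρ n
    rw [integral_add_measure (hρ n) (hneg ρ hρ n), integral_map (by fun_prop) (by fun_prop),
      add_mul, one_mul, ← integral_const_mul]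
    simp_rw [← mul_pow, neg_one_mul]
  have hintabs : ∀ (ρ : Measure ℝ), (∀ n : ℕ, Integrable (fun x => x ^ n) ρ) → ∀ n : ℕ,
      ∫ x, |x| ^ n ∂(ρ + ρ.map Neg.neg) = 2 * ∫ x, |x| ^ n ∂ρ := by
    intro ρ hρ n
    rw [integral_add_measure (by simpa [abs_pow] using (hρ n).abs)
      (by simpa [abs_pow] using (hneg ρ hρ n).abs), integral_map (by fun_prop) (by fun_prop)]
    simp_rw [abs_neg, two_mul]
  have hsymm : ν + ν.map Neg.neg = μ + μ.map Neg.neg := by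
    refine Measure.eq_of_moments_of_not_summable_inv (M₀ := 4 * M₀) hr hmono hsum
      (fun n => (hν' n).add_measure (hneg ν hν' n)) (fun n => (hμ n).add_measure (hneg μ hμ n))
      (fun n => ?_) (fun n => ?_) (fun n => ?_)
    · rw [hint ν hν', hint μ hμ]
      obtain ⟨k, rfl | rfl⟩ := Nat.even_or_odd' n
      · rw [heq]
      · simp [pow_succ, pow_mul]
    · rw [hintabs ν hν']; linarith [habsν n]
    · rw [hintabs μ hμ]; linarith [habsμ n]
  have hfold : ∀ ρ : Measure ℝ, ρ (Iio 0) = 0 →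
      (ρ + ρ.map Neg.neg).map (fun x => |x|) = (2 : ENNReal) • ρ := by
    intro ρ hρ
    have hae : (fun x : ℝ => |x|) =ᵐ[ρ] id := by
      have : ∀ᵐ x ∂ρ, x ∉ Iio 0 := measure_eq_zero_iff_ae_notMem.1 hρ
      filter_upwards [this] with x hx
      exact abs_of_nonneg (not_lt.1 hx)
    rw [Measure.map_add _ _ (by fun_prop), Measure.map_map (by fun_prop) (by fun_prop)]
    have : (fun x : ℝ => |x|) ∘ Neg.neg = fun x => |x| := by ext x; simp
    rw [this, Measure.map_congr hae, Measure.map_id, two_smul]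
  have h2 := congrArg (Measure.map fun x => |x|) hsymm
  rw [hfold ν hν0, hfold μ hμ0] at h2
  ext s _
  have h3 := congrArg (fun ρ : Measure ℝ => ρ s) h2
  simpa [ENNReal.mul_right_inj] using h3

/-- The weight `n log (n + 3)` governing the growth of the moments. -/
noncomputable def logWeight (n : ℕ) : ℝ := n * Real.log (n + 3)

lemma one_le_log_natCast_add_three (n : ℕ) : 1 ≤ Real.log ((n : ℝ) + 3) := by
  rw [Real.le_log_iff_exp_le (by positivity)]
  have := Real.exp_one_lt_d9
  have : (0 : ℝ) ≤ n := n.cast_nonneg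
  linarith

lemma natCast_le_logWeight (n : ℕ) : (n : ℝ) ≤ logWeight n :=
  le_mul_of_one_le_right n.cast_nonneg (one_le_log_natCast_add_three n)

lemma logWeight_nonneg (n : ℕ) : 0 ≤ logWeight n :=
  n.cast_nonneg.trans (natCast_le_logWeight n)

lemma one_le_logWeight {n : ℕ} (hn : 1 ≤ n) : 1 ≤ logWeight n :=
  (by exact_mod_cast hn : (1 : ℝ) ≤ n).trans (natCast_le_logWeight n)

lemma logWeight_monotone : Monotone logWeight := by
  intro m n h
  have h' : (m : ℝ) ≤ n := by exact_mod_cast h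
  have := one_le_log_natCast_add_three m
  unfold logWeight
  gcongr

lemma mul_logWeight_succ_le (n : ℕ) : n * logWeight (n + 1) ≤ (n + 2) * logWeight n := by
  have hn : (0 : ℝ) ≤ n := n.cast_nonneg
  have h1 := one_le_log_natCast_add_three n
  have h2 : Real.log ((n : ℝ) + 1 + 3) ≤ Real.log (n + 3) + 1 / (n + 3) := by
    have h := Real.log_le_sub_one_of_pos (x := ((n : ℝ) + 1 + 3) / (n + 3)) (by positivity)
    rw [Real.log_div (by positivity) (by positivity)] at h
    have e : ((n : ℝ) + 1 + 3) / (n + 3) - 1 = 1 / (n + 3) := by field_simp; ring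
    linarith
  have h3 : ((n : ℝ) + 1) * (1 / (n + 3)) ≤ 1 := by
    rw [mul_one_div, div_le_one (by positivity)]; linarith
  have h4 : ((n : ℝ) + 1) * Real.log ((n : ℝ) + 1 + 3) ≤ (n + 2) * Real.log (n + 3) := by
    nlinarith
  have := mul_le_mul_of_nonneg_left h4 hn
  unfold logWeight
  push_cast
  linarith

lemma logWeight_succ_succ_le (n : ℕ) : logWeight (n + 1 + 1) ≤ 3 * logWeight (n + 1) := by
  have h := mul_logWeight_succ_le (n + 1)
  have h0 := logWeight_nonneg (n + 1)
  have hn : (0 : ℝ) ≤ n := n.cast_nonneg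
  push_cast at h
  have : ((n : ℝ) + 1) * logWeight (n + 1 + 1) ≤ (n + 1) * (3 * logWeight (n + 1)) := by
    nlinarith [mul_nonneg hn h0]
  exact le_of_mul_le_mul_left this (by positivity)

lemma logWeight_two_mul_le (n : ℕ) : logWeight (2 * n) ≤ 4 * logWeight n := by
  have hn : (0 : ℝ) ≤ n := n.cast_nonneg
  have h : Real.log (2 * n + 3) ≤ 2 * Real.log (n + 3) := by
    have e : 2 * Real.log ((n : ℝ) + 3) = Real.log ((n + 3) ^ 2) := by
      rw [Real.log_pow]; norm_num
    rw [e]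
    exact Real.log_le_log (by positivity) (by nlinarith)
  have := mul_le_mul_of_nonneg_left h hn
  unfold logWeight
  push_cast
  linarith

lemma logWeight_pow_self_le_prod (n : ℕ) :
    logWeight n ^ n ≤ ∏ i ∈ Finset.range n, Real.exp 2 * logWeight (i + 1) := by
  induction n with
  | zero => simp
  | succ n ih =>
    rw [Finset.prod_range_succ, pow_succ]
    have hw := logWeight_nonneg (n + 1)
    have hstep : logWeight (n + 1) ^ n ≤ Real.exp 2 * logWeight n ^ n := by
      rcases Nat.eq_zero_or_pos n with rfl | hn
      · simp
      · have hn' : (0 : ℝ) < n := by exact_mod_cast hn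
        have h1 : logWeight (n + 1) ≤ Real.exp (2 / n) * logWeight n := by
          have h2 : logWeight (n + 1) ≤ (2 / n + 1) * logWeight n := by
            have e : (2 / (n : ℝ) + 1) * logWeight n = (n + 2) * logWeight n / n := by
              field_simp; ring
            rw [e, le_div_iff₀ hn']
            linarith [mul_logWeight_succ_le n]
          exact h2.trans (mul_le_mul_of_nonneg_right (Real.add_one_le_exp _) (logWeight_nonneg n))
        calc _ ≤ (Real.exp (2 / n) * logWeight n) ^ n := pow_le_pow_left₀ hw h1 n
          _ = _ := by
            rw [mul_pow, ← Real.exp_nat_mul, mul_div_cancel₀ _ hn'.ne']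
    calc logWeight (n + 1) ^ n * logWeight (n + 1)
        ≤ Real.exp 2 * logWeight n ^ n * logWeight (n + 1) := mul_le_mul_of_nonneg_right hstep hw
      _ ≤ Real.exp 2 * (∏ i ∈ Finset.range n, Real.exp 2 * logWeight (i + 1)) *
          logWeight (n + 1) := by gcongr
      _ = _ := by ring

lemma not_summable_inv_logWeight : ¬ Summable fun n => (logWeight n)⁻¹ := by
  rw [← summable_condensed_iff_of_nonneg (fun n => inv_nonneg.2 (logWeight_nonneg n))
    (fun m n hm hmn => inv_anti₀ (by linarith [one_le_logWeight hm]) (logWeight_monotone hmn))]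
  intro h
  have h2 : Summable fun k : ℕ => ((k : ℝ) + 2)⁻¹ * (Real.log 2)⁻¹ := by
    refine h.of_nonneg_of_le (fun k => by have := Real.log_pos one_lt_two; positivity)
      (fun k => ?_)
    have hl : Real.log (((2 ^ k : ℕ) : ℝ) + 3) ≤ (k + 2) * Real.log 2 := by
      have e : ((k : ℝ) + 2) * Real.log 2 = Real.log (2 ^ (k + 2)) := by
        rw [Real.log_pow]; push_cast; ring
      rw [e]
      refine Real.log_le_log (by positivity) ?_
      have : (1 : ℝ) ≤ 2 ^ k := one_le_pow₀ (by norm_num)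
      rw [pow_add]; push_cast; linarith
    have h1 := one_le_log_natCast_add_three (2 ^ k)
    rw [logWeight, mul_inv, ← mul_assoc, Nat.cast_pow, Nat.cast_two,
      mul_inv_cancel₀ (by positivity), one_mul, ← mul_inv]
    rw [Nat.cast_pow, Nat.cast_two] at hl h1
    exact inv_anti₀ (by linarith) hl
  rw [summable_mul_right_iff (inv_ne_zero (Real.log_pos one_lt_two).ne')] at h2
  have h3 : Summable fun k : ℕ => ((k + 2 : ℕ) : ℝ)⁻¹ := by simpa using h2
  exact Real.not_summable_natCast_inv
    ((summable_nat_add_iff (f := fun k : ℕ => (k : ℝ)⁻¹) 2).1 h3)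

lemma tendsto_sum_rpow_atTop_of_le_logWeight_pow {v : ℕ → ℝ} {B : ℝ} (hB : 0 < B)
    (hv : ∀ n, 0 < v n) (hle : ∀ n, 1 ≤ n → v n ≤ (B * logWeight n) ^ (2 * n)) :
    Tendsto (fun N : ℕ => ∑ n ∈ Finset.Icc 1 N, v n ^ (-(1 : ℝ) / (2 * n))) atTop atTop := by
  have hnot : ¬ Summable fun n => B⁻¹ * (logWeight n)⁻¹ := by
    rw [summable_mul_left_iff (inv_ne_zero hB.ne')]
    exact not_summable_inv_logWeight
  have htend := (tendsto_add_atTop_iff_nat 1).2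
    ((not_summable_iff_tendsto_nat_atTop_of_nonneg (fun n =>
      mul_nonneg (inv_nonneg.2 hB.le) (inv_nonneg.2 (logWeight_nonneg n)))).1 hnot)
  refine tendsto_atTop_mono (fun N => ?_) htend
  rw [Finset.sum_range_succ', show logWeight 0 = 0 by simp [logWeight], inv_zero, mul_zero,
    add_zero, show Finset.Icc 1 N = Finset.Ico 1 (N + 1) by grind, Finset.sum_Ico_eq_sum_range]
  simp only [Nat.add_sub_cancel]
  refine Finset.sum_le_sum fun i _ => ?_
  rw [add_comm 1 i]
  have hw := one_le_logWeight (Nat.le_add_left 1 i)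
  have hpos : 0 < B * logWeight (i + 1) := by positivity
  have hn : (2 * ((i + 1 : ℕ) : ℝ)) ≠ 0 := by positivity
  calc B⁻¹ * (logWeight (i + 1))⁻¹
      = ((B * logWeight (i + 1)) ^ (2 * (i + 1))) ^ (-(1 : ℝ) / (2 * (i + 1 : ℕ))) := by
        rw [← Real.rpow_natCast, ← Real.rpow_mul hpos.le, Nat.cast_mul, Nat.cast_two,
          mul_div_cancel₀ _ hn, Real.rpow_neg_one, mul_inv]
    _ ≤ _ := Real.rpow_le_rpow_of_nonpos (hv _) (hle _ (Nat.le_add_left 1 i))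
        (div_nonpos_of_nonpos_of_nonneg (by norm_num) (by positivity))

lemma integral_pow_le_of_tail_contraction {μ : Measure ℝ} [IsProbabilityMeasure μ]
    (hsupp : μ (Iio 0) = 0) {n : ℕ} (hint : Integrable (fun x => x ^ n) μ)
    {R T q : ℝ} (hR : 0 ≤ R) (hRT : R ≤ T) (hq0 : 0 ≤ q) (hq1 : q < 1)
    (h : ∫⁻ y in Ici T, ENNReal.ofReal (y ^ n) ∂μ ≤
      ENNReal.ofReal q * ∫⁻ x in Ici R, ENNReal.ofReal (x ^ n) ∂μ) :
    ∫ x, x ^ n ∂μ ≤ T ^ n / (1 - q) := by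
  have hT : 0 ≤ T := hR.trans hRT
  have hconv : ∀ a : ℝ, 0 ≤ a → ∫⁻ x in Ici a, ENNReal.ofReal (x ^ n) ∂μ =
      ENNReal.ofReal (∫ x in Ici a, x ^ n ∂μ) := fun a ha =>
    (ofReal_integral_eq_lintegral_ofReal hint.integrableOn
      ((ae_restrict_iff' measurableSet_Ici).2 (.of_forall fun x hx =>
        pow_nonneg (ha.trans hx) n))).symm
  have hnn : ∀ a : ℝ, 0 ≤ a → 0 ≤ ∫ x in Ici a, x ^ n ∂μ := fun a ha =>
    setIntegral_nonneg measurableSet_Ici fun x hx => pow_nonneg (ha.trans hx) n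
  rw [hconv T hT, hconv R hR, ← ENNReal.ofReal_mul hq0,
    ENNReal.ofReal_le_ofReal_iff (mul_nonneg hq0 (hnn R hR))] at h
  have hIco : ∀ a : ℝ, 0 ≤ a → ∫ x in Ico a T, x ^ n ∂μ ≤ T ^ n := by
    intro a ha
    have h1 := norm_setIntegral_le_of_norm_le_const (μ := μ) (s := Ico a T) (C := T ^ n)
      (f := fun x => x ^ n) (measure_lt_top _ _) (fun x hx => by
        have hx0 := ha.trans hx.1
        rw [Real.norm_of_nonneg (pow_nonneg hx0 n)]
        exact pow_le_pow_left₀ hx0 hx.2.le n)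
    refine (le_abs_self _).trans (h1.trans (mul_le_of_le_one_right (by positivity) ?_))
    exact measureReal_le_one
  have hsplit : ∀ a : ℝ, 0 ≤ a → a ≤ T →
      ∫ x in Ici a, x ^ n ∂μ ≤ T ^ n + ∫ x in Ici T, x ^ n ∂μ := by
    intro a ha haT
    rw [← Ico_union_Ici_eq_Ici haT, setIntegral_union
      (disjoint_left.2 fun x (hx : x ∈ Ico a T) (hx' : x ∈ Ici T) => hx.2.not_ge hx')
      measurableSet_Ici
      hint.integrableOn hint.integrableOn]
    linarith [hIco a ha]
  have htot : ∫ x, x ^ n ∂μ = ∫ x in Ici 0, x ^ n ∂μ := by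
    rw [Measure.restrict_eq_self_of_ae_mem]
    filter_upwards [measure_eq_zero_iff_ae_notMem.1 hsupp] with x hx
    simpa using hx
  have h0 := hsplit 0 le_rfl hT
  have h1 := hsplit R hR hRT
  rw [htot, le_div_iff₀ (by linarith)]
  have h2 := mul_le_mul_of_nonneg_left h1 hq0
  nlinarith [mul_le_mul_of_nonneg_right h0 (by linarith : 0 ≤ 1 - q)]

lemma setLIntegral_mul_of_restrict_eq_withDensity {μ : Measure ℝ} {x₀ : ℝ} {g : ℝ → ℝ}
    (hg_meas : Measurable g)
    (hg_ac : μ.restrict (Ici x₀) =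
      (volume.restrict (Ici x₀)).withDensity (fun x => ENNReal.ofReal (g x)))
    {s : Set ℝ} (hs : MeasurableSet s) (hsub : s ⊆ Ici x₀) {F : ℝ → ENNReal}
    (hF : Measurable F) :
    ∫⁻ x in s, F x ∂μ = ∫⁻ x in s, F x * ENNReal.ofReal (g x) := by
  have h1 : μ.restrict s = (volume.restrict s).withDensity (fun x => ENNReal.ofReal (g x)) := by
    have := congrArg (fun ρ : Measure ℝ => ρ.restrict s) hg_ac
    simp only [restrict_withDensity hs, Measure.restrict_restrict hs,
      inter_eq_self_of_subset_left hsub] at this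
    exact this
  rw [h1, lintegral_withDensity_eq_lintegral_mul _ hg_meas.ennreal_ofReal hF]
  simp [mul_comm]

/-- Change of variables `x = X y`: pointwise contraction of the density along `X` gives
contraction of the tail moments. -/
lemma setLIntegral_pow_le_of_density_contraction {μ : Measure ℝ} {x₀ : ℝ} (hx₀ : 0 < x₀)
    {g : ℝ → ℝ} (hg_meas : Measurable g) (hg_pos : ∀ x ∈ Ici x₀, 0 < g x)
    (hg_ac : μ.restrict (Ici x₀) =
      (volume.restrict (Ici x₀)).withDensity (fun x => ENNReal.ofReal (g x)))
    {X X' : ℝ → ℝ} {T R ρ κ : ℝ} {n : ℕ} (hT : x₀ ≤ T) (hR : x₀ ≤ R) (hρ : 0 ≤ ρ) (hκ : 0 ≤ κ)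
    (hX : ∀ y ∈ Ici T, HasDerivAt X (X' y) y) (hinj : InjOn X (Ici T))
    (hXR : ∀ y ∈ Ici T, R ≤ X y) (hX' : ∀ y ∈ Ici T, 1 ≤ κ * X' y)
    (hpow : ∀ y ∈ Ici T, y ^ n ≤ κ * X y ^ n) (hg : ∀ y ∈ Ici T, g y ≤ ρ * g (X y)) :
    ∫⁻ y in Ici T, ENNReal.ofReal (y ^ n) ∂μ ≤
      ENNReal.ofReal (ρ * κ ^ 2) * ∫⁻ x in Ici R, ENNReal.ofReal (x ^ n) ∂μ := by
  have hF : Measurable fun x : ℝ => ENNReal.ofReal (x ^ n) := by fun_prop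
  rw [setLIntegral_mul_of_restrict_eq_withDensity hg_meas hg_ac measurableSet_Ici
      (Ici_subset_Ici.2 hT) hF,
    setLIntegral_mul_of_restrict_eq_withDensity hg_meas hg_ac measurableSet_Ici
      (Ici_subset_Ici.2 hR) hF]
  have himg : X '' Ici T ⊆ Ici R := by
    rintro _ ⟨y, hy, rfl⟩
    exact hXR y hy
  calc ∫⁻ y in Ici T, ENNReal.ofReal (y ^ n) * ENNReal.ofReal (g y)
      ≤ ∫⁻ y in Ici T, ENNReal.ofReal (ρ * κ ^ 2) * (ENNReal.ofReal |X' y| *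
          (ENNReal.ofReal (X y ^ n) * ENNReal.ofReal (g (X y)))) := by
        refine setLIntegral_mono' measurableSet_Ici fun y hy => ?_
        have hy0 : 0 ≤ y := hx₀.le.trans (hT.trans hy)
        have hXy : x₀ ≤ X y := hR.trans (hXR y hy)
        have hXn : 0 ≤ X y ^ n := pow_nonneg (hx₀.le.trans hXy) n
        have hgX := (hg_pos _ hXy).le
        have hq : 0 ≤ ρ * κ ^ 2 := by positivity
        rw [← ENNReal.ofReal_mul (pow_nonneg hy0 n), ← ENNReal.ofReal_mul hXn,
          ← ENNReal.ofReal_mul (abs_nonneg _), ← ENNReal.ofReal_mul hq]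
        refine ENNReal.ofReal_le_ofReal ?_
        have h1 : y ^ n * g y ≤ (κ * X y ^ n) * (ρ * g (X y)) :=
          mul_le_mul (hpow y hy) (hg y hy) (hg_pos y (hT.trans hy)).le (by positivity)
        have h2 : 1 ≤ κ * |X' y| :=
          (hX' y hy).trans (mul_le_mul_of_nonneg_left (le_abs_self _) hκ)
        have h3 := mul_le_mul_of_nonneg_left h2
          (by positivity : 0 ≤ (κ * X y ^ n) * (ρ * g (X y)))
        linarith
    _ = ENNReal.ofReal (ρ * κ ^ 2) * ∫⁻ x in X '' Ici T,
          ENNReal.ofReal (x ^ n) * ENNReal.ofReal (g x) := by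
        rw [lintegral_const_mul' _ _ ENNReal.ofReal_ne_top,
          lintegral_image_eq_lintegral_abs_deriv_mul measurableSet_Ici
            (fun y hy => (hX y hy).hasDerivWithinAt) hinj]
    _ ≤ _ := by gcongr

lemma pow_le_mul_pow_sub_log {n : ℕ} {C δ y z : ℝ} (hδ1 : δ < 1) (hy : 0 < y)
    (hz : y - C * Real.log y ≤ z) (hz0 : 0 ≤ z) (h : n * (C * Real.log y) ≤ δ * y) :
    y ^ n ≤ (1 - δ)⁻¹ * z ^ n := by
  have h1 : 1 - δ ≤ (z / y) ^ n := by
    have hb := one_add_mul_le_pow (a := z / y - 1) (by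
      have : 0 ≤ z / y := by positivity
      linarith) n
    rw [add_sub_cancel] at hb
    refine le_trans ?_ hb
    have h2 : -(C * Real.log y) / y ≤ z / y - 1 := by
      rw [div_sub_one hy.ne']
      exact div_le_div_of_nonneg_right (by linarith) hy.le
    have h3 := mul_le_mul_of_nonneg_left h2 (n.cast_nonneg : (0 : ℝ) ≤ n)
    have h4 : n * (C * Real.log y) / y ≤ δ := by rwa [div_le_iff₀ hy]
    have e : n * (-(C * Real.log y) / y) = -(n * (C * Real.log y) / y) := by ring
    linarith
  rw [div_pow, le_div_iff₀ (by positivity)] at h1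
  rw [inv_mul_eq_div, le_div_iff₀ (by linarith)]
  linarith

/-- For `A` large, `C * n * log y` is at most `δ * y` beyond `A * logWeight n`. -/
lemma eventually_forall_mul_log_le {C δ : ℝ} (hC : 0 < C) (hδ : 0 < δ) :
    ∀ᶠ A : ℝ in atTop, ∀ n : ℕ, 1 ≤ n → ∀ y, A * logWeight n ≤ y →
      n * (C * Real.log y) ≤ δ * y := by
  have hlog : ∀ᶠ A : ℝ in atTop, C * (Real.log A + 2) ≤ δ * A := by
    have h1 := (Real.isLittleO_log_id_atTop.def (by positivity : 0 < δ / (2 * C)))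
    filter_upwards [h1, eventually_ge_atTop (4 * C / δ), eventually_ge_atTop 0] with A hA hA2 hA0
    rw [id, Real.norm_of_nonneg hA0] at hA
    have h2 : Real.log A ≤ δ / (2 * C) * A := (le_abs_self _).trans hA
    rw [div_le_iff₀ hδ] at hA2
    have h3 := mul_le_mul_of_nonneg_left h2 hC.le
    have e : C * (δ / (2 * C) * A) = δ * A / 2 := by field_simp
    linarith
  filter_upwards [hlog, eventually_ge_atTop (Real.exp 1)] with A hA hAe n hn y hy
  have hA1 : 1 ≤ A := (Real.one_le_exp zero_le_one).trans hAe
  have hw := one_le_logWeight hn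
  set T := A * logWeight n with hT
  have hTe : Real.exp 1 ≤ T := hAe.trans (le_mul_of_one_le_right (by linarith) hw)
  have hTpos : 0 < T := (Real.exp_pos 1).trans_le hTe
  have hypos := hTpos.trans_le hy
  have hanti : Real.log y / y ≤ Real.log T / T :=
    Real.log_div_self_antitoneOn hTe (hTe.trans hy) hy
  have hn0 : (0 : ℝ) < n := by exact_mod_cast hn
  set l := Real.log ((n : ℝ) + 3) with hl
  have hl1 : 1 ≤ l := one_le_log_natCast_add_three n
  have hlogT : Real.log T ≤ (Real.log A + 2) * l := by
    have hlogA : 0 ≤ Real.log A := Real.log_nonneg hA1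
    have e : Real.log T = Real.log A + (Real.log n + Real.log l) := by
      rw [hT, logWeight, Real.log_mul (by positivity) (by positivity),
        Real.log_mul (by positivity) (by positivity)]
    have h1 : Real.log n ≤ l := Real.log_le_log hn0 (by linarith)
    have h2 : Real.log l ≤ l := (Real.log_le_sub_one_of_pos (by linarith)).trans (by linarith)
    nlinarith
  have hmain : n * (C * Real.log T) ≤ δ * T := by
    have h1 := mul_le_mul_of_nonneg_left hlogT (by positivity : 0 ≤ n * C)
    have h2 := mul_le_mul_of_nonneg_left hA (by positivity : 0 ≤ n * l)
    have e : δ * T = n * l * (δ * A) := by rw [hT, logWeight]; ring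
    linarith
  rw [div_le_div_iff₀ hypos hTpos] at hanti
  have h1 := mul_le_mul_of_nonneg_left hanti (by positivity : 0 ≤ n * C)
  have h2 := mul_le_mul_of_nonneg_right hmain hypos.le
  refine le_of_mul_le_mul_right ?_ hTpos
  linarith

/-- Growth of the moments under the limsup condition on the density. -/
lemma exists_moment_le_logWeight_pow
    {x₀ : ℝ} (hx₀ : 0 < x₀) {φ : ℝ → ℝ} (hφ_nonneg : ∀ x ∈ Ici x₀, 0 ≤ φ x)
    (hmono : StrictMonoOn (fun x => x + φ x) (Ici x₀)) {xinv : ℝ → ℝ}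
    (hinv₂ : ∀ y ∈ Ici (x₀ + φ x₀), xinv y ∈ Ici x₀ ∧ xinv y + φ (xinv y) = y)
    {ψ ψ' : ℝ → ℝ} (hψ : ∀ y, ψ y = y - xinv y)
    {C ystar : ℝ} (hC : 0 < C) (hystar : x₀ + φ x₀ ≤ ystar)
    (hψ_deriv : ∀ y ∈ Ici ystar, HasDerivAt ψ (ψ' y) y)
    (hcond_b : ∀ y ∈ Ici ystar, ψ y ≤ C * Real.log y)
    (hcond_c : ∀ y ∈ Ici ystar, y * ψ' y ≤ C)
    {μ : Measure ℝ} [IsProbabilityMeasure μ] (hsupp : μ (Iio 0) = 0)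
    (hmom : ∀ n : ℕ, Integrable (fun x => x ^ n) μ)
    {g : ℝ → ℝ} (hg_meas : Measurable g)
    (hg_ac : μ.restrict (Ici x₀) =
      (volume.restrict (Ici x₀)).withDensity (fun x => ENNReal.ofReal (g x)))
    (hg_pos : ∀ x ∈ Ici x₀, 0 < g x)
    (hlimsup : Filter.limsup
        (fun x => ENNReal.ofReal (g (x + φ x) / g x)) atTop < 1) :
    ∃ K A : ℝ, 1 ≤ K ∧ 1 ≤ A ∧ ∀ n : ℕ, ∫ x, x ^ n ∂μ ≤ K * (A * logWeight n) ^ n := by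
  obtain ⟨ρ, hρ0, hρ1, X₁, hX₁, hratio⟩ : ∃ ρ : ℝ, 0 ≤ ρ ∧ ρ < 1 ∧ ∃ X₁ : ℝ, x₀ ≤ X₁ ∧
      ∀ x, X₁ ≤ x → g (x + φ x) ≤ ρ * g x := by
    obtain ⟨r, hr, hr1⟩ := exists_between hlimsup
    have hrtop : r ≠ ⊤ := (hr1.trans ENNReal.one_lt_top).ne
    obtain ⟨X, hX⟩ := eventually_atTop.1 (eventually_lt_of_limsup_lt hr)
    refine ⟨r.toReal, ENNReal.toReal_nonneg, ?_, max X x₀, le_max_right _ _, fun x hx => ?_⟩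
    · simpa using (ENNReal.toReal_lt_toReal hrtop ENNReal.one_ne_top).2 hr1
    · have h := (ENNReal.ofReal_le_iff_le_toReal hrtop).1 (hX x ((le_max_left _ _).trans hx)).le
      rwa [div_le_iff₀ (hg_pos x ((le_max_right _ _).trans hx))] at h
  have hxinv_ge : ∀ a, x₀ ≤ a → ∀ y, a + φ a ≤ y → a ≤ xinv y := by
    intro a ha y hy
    have hy₀ : x₀ + φ x₀ ≤ y := (hmono.monotoneOn self_mem_Ici ha ha).trans hy
    by_contra! hlt
    have := hmono (hinv₂ y hy₀).1 ha hlt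
    simp only [(hinv₂ y hy₀).2] at this
    linarith
  set δ := (1 - ρ) / 2 with hδ
  have hδ0 : 0 < δ := by linarith
  have hδ1 : δ < 1 := by linarith
  set κ := (1 - δ)⁻¹ with hκ
  have hκ0 : 0 < κ := inv_pos.2 (by linarith)
  set q := ρ * κ ^ 2 with hq
  have hq0 : 0 ≤ q := by positivity
  have hq1 : q < 1 := by
    rw [hq, hκ, inv_pow, ← div_eq_mul_inv, div_lt_one (pow_pos (by linarith) 2)]
    nlinarith [sq_pos_of_pos hδ0]
  obtain ⟨A, hAlog, hAst, hAX, hAC, hA1⟩ := ((eventually_forall_mul_log_le hC hδ0).and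
    ((eventually_ge_atTop ystar).and ((eventually_ge_atTop (X₁ + φ X₁)).and
      ((eventually_ge_atTop (C / δ)).and (eventually_ge_atTop 1))))).exists
  refine ⟨(1 - q)⁻¹, A, (one_le_inv₀ (by linarith)).2 (by linarith), hA1, fun n => ?_⟩
  rcases Nat.eq_zero_or_pos n with rfl | hn
  · simpa using (one_le_inv₀ (by linarith : 0 < 1 - q)).2 (by linarith)
  set T := A * logWeight n with hT
  have hAT : A ≤ T := le_mul_of_one_le_right (by linarith) (one_le_logWeight hn)
  have hTst : ystar ≤ T := hAst.trans hAT
  have hTy₀ : x₀ + φ x₀ ≤ T := hystar.trans hTst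
  have hinvT := hinv₂ T hTy₀
  have hRT : xinv T ≤ T := by linarith [hφ_nonneg _ hinvT.1, hinvT.2]
  have hxT : x₀ ≤ T := le_trans hinvT.1 hRT
  have hX : xinv = fun y => y - ψ y := by ext y; rw [hψ]; ring
  rw [inv_mul_eq_div]
  refine integral_pow_le_of_tail_contraction hsupp (hmom n) (hx₀.le.trans hinvT.1) hRT hq0 hq1 ?_
  refine setLIntegral_pow_le_of_density_contraction (X := xinv) (X' := fun y => 1 - ψ' y) hx₀
    hg_meas hg_pos hg_ac hxT hinvT.1 hρ0 hκ0.le ?_ ?_ ?_ ?_ ?_ ?_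
  · intro y hy
    rw [hX]
    exact (hasDerivAt_id y).sub (hψ_deriv y (hTst.trans hy))
  · intro y hy z hz hyz
    rw [← (hinv₂ y (hTy₀.trans hy)).2, ← (hinv₂ z (hTy₀.trans hz)).2, hyz]
  · intro y hy
    exact hxinv_ge _ hinvT.1 y (hinvT.2.trans_le hy)
  · intro y hy
    have hy : T ≤ y := hy
    have hypos : 0 < y := by linarith
    have h1 := hcond_c y (hTst.trans hy)
    have h2 : C ≤ δ * y := by
      have := (div_le_iff₀ hδ0).1 (hAC.trans (hAT.trans hy))
      linarith
    have h3 : ψ' y ≤ δ := le_of_mul_le_mul_left (by linarith : y * ψ' y ≤ y * δ) hypos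
    rw [hκ, inv_mul_eq_div, one_le_div (by linarith)]
    linarith
  · intro y hy
    have hy' : T ≤ y := hy
    refine pow_le_mul_pow_sub_log (C := C) hδ1 (by linarith) ?_
      (hx₀.le.trans (hinv₂ y (hTy₀.trans hy)).1) (hAlog n hn y hy)
    linarith [hcond_b y (hTst.trans hy), hψ y]
  · intro y hy
    have h := hratio (xinv y) (hxinv_ge X₁ hX₁ y (hAX.trans (hAT.trans hy)))
    rwa [(hinv₂ y (hTy₀.trans hy)).2] at h

lemma integral_pow_pos_of_density {μ : Measure ℝ} [IsProbabilityMeasure μ]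
    (hsupp : μ (Iio 0) = 0) (hmom : ∀ n : ℕ, Integrable (fun x => x ^ n) μ)
    {x₀ : ℝ} (hx₀ : 0 < x₀) {g : ℝ → ℝ} (hg_meas : Measurable g)
    (hg_ac : μ.restrict (Ici x₀) =
      (volume.restrict (Ici x₀)).withDensity (fun x => ENNReal.ofReal (g x)))
    (hg_pos : ∀ x ∈ Ici x₀, 0 < g x) (n : ℕ) : 0 < ∫ x, x ^ n ∂μ := by
  have hnn : 0 ≤ᵐ[μ] fun x : ℝ => x ^ n := by
    filter_upwards [measure_eq_zero_iff_ae_notMem.1 hsupp] with x hx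
    exact pow_nonneg (by simpa using hx) n
  rw [integral_pos_iff_support_of_nonneg_ae hnn (hmom n)]
  have hsub : Ici x₀ ⊆ Function.support fun x : ℝ => x ^ n := fun x hx =>
    pow_ne_zero n (hx₀.trans_le hx).ne'
  refine lt_of_lt_of_le ?_ (measure_mono hsub)
  have h := setLIntegral_mul_of_restrict_eq_withDensity hg_meas hg_ac measurableSet_Ici
    subset_rfl (F := fun _ => 1) measurable_const
  simp only [lintegral_const, one_mul, Measure.restrict_apply_univ] at h
  rw [h, setLIntegral_pos_iff hg_meas.ennreal_ofReal]
  have : Ici x₀ ⊆ (Function.support fun x => ENNReal.ofReal (g x)) ∩ Ici x₀ := fun x hx =>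
    ⟨by simpa using hg_pos x hx, hx⟩
  refine lt_of_lt_of_le ?_ (measure_mono this)
  simp

/-- Determinacy by even moments under logarithmically corrected factorial growth. -/
lemma eq_of_even_moments_of_le_logWeight_pow {μ ν : Measure ℝ} [IsProbabilityMeasure μ]
    [IsProbabilityMeasure ν] {K A : ℝ} (hK : 1 ≤ K) (hA : 1 ≤ A)
    (hμ0 : μ (Iio 0) = 0) (hν0 : ν (Iio 0) = 0)
    (hμ : ∀ n : ℕ, Integrable (fun x => x ^ n) μ)
    (hbound : ∀ n : ℕ, ∫ x, x ^ n ∂μ ≤ K * (A * logWeight n) ^ n)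
    (h : ∀ n : ℕ, 0 < n → Integrable (fun x => x ^ (2 * n)) ν ∧
      ∫ x, x ^ (2 * n) ∂ν = ∫ x, x ^ (2 * n) ∂μ) : ν = μ := by
  have hA0 : 0 < A := by linarith
  refine eq_of_even_moments_of_nonneg
    (r := fun i => A * (Real.exp 2 * logWeight (i + 1))) (M₀ := K) (fun n => ?_)
    (fun m n hmn => ?_) (fun n => ?_) ?_ hμ0 hν0 hμ (fun n => ?_) (fun n => ?_) (fun n => ?_)
  · have := one_le_logWeight (Nat.le_add_left 1 n)
    positivity
  · have := logWeight_monotone (Nat.add_le_add_right hmn 1)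
    dsimp only
    gcongr
  · have := mul_le_mul_of_nonneg_left (logWeight_succ_succ_le n)
      (by positivity : 0 ≤ A * Real.exp 2)
    linarith
  · simp_rw [← mul_assoc, mul_inv _ (logWeight _)]
    rw [summable_mul_left_iff (by positivity),
      summable_nat_add_iff (f := fun i => (logWeight i)⁻¹) 1]
    exact not_summable_inv_logWeight
  · rcases Nat.eq_zero_or_pos n with rfl | hn
    · simp
    · exact (h n hn).1
  · rcases Nat.eq_zero_or_pos n with rfl | hn
    · simp
    · exact (h n hn).2
  · refine (hbound _).trans (mul_le_mul_of_nonneg_left ?_ (by linarith))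
    rw [mul_pow, Finset.prod_mul_distrib, Finset.prod_const, Finset.card_range]
    exact mul_le_mul_of_nonneg_left (logWeight_pow_self_le_prod _) (by positivity)

/-- Theorem 3 (Stieltjes case): if `limsup_{x→∞} g(x+φ(x))/g(x) < 1` then
`∑ ν_n^{-1/(2n)} = ∞` and `∑ ν_{2n}^{-1/(2n)} = ∞`, and both `Y` and `Y²`
are moment-determinate on `[0,∞)`. -/
theorem theorem3_stieltjes
    (x₀ : ℝ) (hx₀ : 0 < x₀)
    (φ : ℝ → ℝ)
    (hφ_nonneg : ∀ x ∈ Ici x₀, 0 ≤ φ x)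
    (hφ_diff : DifferentiableOn ℝ φ (Ici x₀))
    (hmono : StrictMonoOn (fun x => x + φ x) (Ici x₀))
    (xinv : ℝ → ℝ)
    (hinv₁ : ∀ x ∈ Ici x₀, xinv (x + φ x) = x)
    (hinv₂ : ∀ y ∈ Ici (x₀ + φ x₀), xinv y ∈ Ici x₀ ∧ xinv y + φ (xinv y) = y)
    (ψ ψ' : ℝ → ℝ)
    (hψ : ∀ y, ψ y = y - xinv y)
    (C ystar : ℝ) (hC : 0 < C) (hystar : x₀ + φ x₀ ≤ ystar)
    (hψ_deriv : ∀ y ∈ Ici ystar, HasDerivAt ψ (ψ' y) y)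
    (hcond_a : ∀ y ∈ Ici ystar, ψ' y ∈ Icc (0 : ℝ) 1)
    (hcond_b : ∀ y ∈ Ici ystar, ψ y ≤ C * Real.log y)
    (hcond_c : ∀ y ∈ Ici ystar, y * ψ' y ≤ C)
    (μ : Measure ℝ) [IsProbabilityMeasure μ]
    (hsupp : μ (Iio 0) = 0)
    (hmom : ∀ n : ℕ, Integrable (fun x => x ^ n) μ)
    (g : ℝ → ℝ) (hg_meas : Measurable g)
    (hg_ac : μ.restrict (Ici x₀) =
      (volume.restrict (Ici x₀)).withDensity (fun x => ENNReal.ofReal (g x)))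
    (hg_pos : ∀ x ∈ Ici x₀, 0 < g x)
    (hlimsup : Filter.limsup
        (fun x => ENNReal.ofReal (g (x + φ x) / g x)) atTop < 1) :
    Tendsto (fun N : ℕ => ∑ n ∈ Finset.Icc 1 N,
        (∫ x, x ^ n ∂μ) ^ (-(1 : ℝ) / (2 * n))) atTop atTop ∧
    Tendsto (fun N : ℕ => ∑ n ∈ Finset.Icc 1 N,
        (∫ x, x ^ (2 * n) ∂μ) ^ (-(1 : ℝ) / (2 * n))) atTop atTop ∧
    IsMomentDetOnNonneg μ ∧
    IsMomentDetOnNonneg (μ.map (fun x => x ^ 2)) := by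
  obtain ⟨K, A, hK, hA, hbound⟩ := exists_moment_le_logWeight_pow hx₀ hφ_nonneg hmono hinv₂ hψ hC
    hystar hψ_deriv hcond_b hcond_c hsupp hmom hg_meas hg_ac hg_pos hlimsup
  have hpos := integral_pow_pos_of_density hsupp hmom hx₀ hg_meas hg_ac hg_pos
  have hKA : 1 ≤ K * A := one_le_mul_of_one_le_of_one_le hK hA
  have hbound' : ∀ n : ℕ, 1 ≤ n → ∫ x, x ^ n ∂μ ≤ (K * A * logWeight n) ^ n := by
    intro n hn
    have hw := logWeight_nonneg n
    refine (hbound n).trans ?_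
    rw [mul_assoc K, mul_pow K]
    exact mul_le_mul_of_nonneg_right (le_self_pow₀ hK (by omega)) (by positivity)
  refine ⟨?_, ?_, ?_, ?_⟩
  · refine tendsto_sum_rpow_atTop_of_le_logWeight_pow (B := K * A) (by linarith) hpos
      fun n hn => (hbound' n hn).trans ?_
    exact pow_le_pow_right₀ (one_le_mul_of_one_le_of_one_le hKA (one_le_logWeight hn)) (by omega)
  · refine tendsto_sum_rpow_atTop_of_le_logWeight_pow (B := K * A * 4) (by linarith)
      (fun n => hpos (2 * n)) fun n hn => (hbound' (2 * n) (by omega)).trans ?_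
    have h1 := mul_le_mul_of_nonneg_left (logWeight_two_mul_le n) (by linarith : 0 ≤ K * A)
    have h2 := logWeight_nonneg (2 * n)
    exact pow_le_pow_left₀ (by positivity) (by linarith) _
  · intro ν hν hν0 h
    exact eq_of_even_moments_of_le_logWeight_pow hK hA hsupp hν0 hmom hbound
      fun n hn => h (2 * n) (by omega)
  · intro ν hν hν0 h
    have hae : ∀ᵐ x ∂ν, 0 ≤ x := by
      filter_upwards [measure_eq_zero_iff_ae_notMem.1 hν0] with x hx
      simpa using hx
    have hsqrt : Measurable Real.sqrt := Real.continuous_sqrt.measurable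
    have : IsProbabilityMeasure (ν.map Real.sqrt) :=
      Measure.isProbabilityMeasure_map hsqrt.aemeasurable
    have hpow : ∀ n : ℕ, (fun x : ℝ => Real.sqrt x ^ (2 * n)) =ᵐ[ν] fun x => x ^ n := by
      intro n
      filter_upwards [hae] with x hx
      rw [pow_mul, Real.sq_sqrt hx]
    have key : ν.map Real.sqrt = μ := by
      refine eq_of_even_moments_of_le_logWeight_pow hK hA hsupp ?_ hmom hbound fun n hn => ⟨?_, ?_⟩
      · rw [Measure.map_apply hsqrt measurableSet_Iio]
        have : Real.sqrt ⁻¹' Iio 0 = ∅ := by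
          ext x
          simp [Real.sqrt_nonneg]
        rw [this, measure_empty]
      · rw [integrable_map_measure (by fun_prop) hsqrt.aemeasurable]
        exact (h n hn).1.congr (hpow n).symm
      · rw [integral_map hsqrt.aemeasurable (by fun_prop), integral_congr_ae (hpow n),
          (h n hn).2, integral_map (by fun_prop) (by fun_prop)]
        simp_rw [← pow_mul]
    rw [← key, Measure.map_map (by fun_prop) hsqrt]
    have hid : ((fun x : ℝ => x ^ 2) ∘ Real.sqrt) =ᵐ[ν] id := by
      filter_upwards [hae] with x hx
      exact Real.sq_sqrt hx
    rw [Measure.map_congr hid, Measure.map_id]
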